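/- There exists an effectively computable real constant c > 0 with the following property. Let F be an imaginary quadratic field and let S be the (finite) set of rational primes that ramify in F. Then there exists a rational prime p with p ≤ 2·(4·∏_{q∈S} q)^c such that p splits in F, i.e. the ideal pO_F is the product of two distinct prime ideals of O_F. -/

import Mathlib

open NumberField

/-- The rational prime `q` ramifies in the number field `F`: the factorization of `q𝓞_F`
contains a repeated prime ideal. -/
def RatPrimeRamifies (F : Type) [Field F] [NumberField F] (q : ℕ) : Prop :=
  ∃ P : Ideal (𝓞 F), P.IsPrime ∧ P ^ 2 ∣ Ideal.span {(q : 𝓞 F)}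

/-- The rational prime `p` splits in the number field `F`: `p𝓞_F` is a product of two
distinct prime ideals. -/
def RatPrimeSplits (F : Type) [Field F] [NumberField F] (p : ℕ) : Prop :=
  ∃ P Q : Ideal (𝓞 F), P.IsPrime ∧ Q.IsPrime ∧ P ≠ Q ∧
    Ideal.span {(p : 𝓞 F)} = P * Q

section QuadraticField

variable {F : Type} [Field F] [NumberField F]

/-- An imaginary quadratic field is generated by a square root of `-d` with `d` squarefree. -/
theorem exists_sq_eq_neg_squarefree (h2 : Module.finrank ℚ F = 2) (hreal : IsEmpty (F →+* ℝ)) :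
    ∃ (σ : F ≃ₐ[ℚ] F) (α : F) (d : ℕ), Squarefree d ∧ α ^ 2 = -(d : F) ∧ σ α = -α := by
  have : Algebra.IsQuadraticExtension ℚ F := ⟨h2⟩
  have hcard : Nat.card (F ≃ₐ[ℚ] F) = 2 := by rw [IsGalois.card_aut_eq_finrank, h2]
  obtain ⟨σ, hσ, hall⟩ := (Nat.card_eq_two_iff' (1 : F ≃ₐ[ℚ] F)).1 hcard
  have hσσ : ∀ x, σ (σ x) = x := by
    by_contra! h
    obtain ⟨x, hx⟩ := h
    have h1 : σ * σ = σ := hall _ fun h => hx (by simpa using DFunLike.congr_fun h x)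
    exact hσ (mul_eq_left.1 h1)
  have hfix : ∀ x, σ x = x → ∃ r : ℚ, (r : F) = x := fun x hx => by
    have : x ∈ (⊥ : IntermediateField ℚ F) := by
      rw [IsGalois.mem_bot_iff_fixed]
      intro τ
      by_cases hτ : τ = 1
      · simp [hτ]
      · rw [hall τ hτ, hx]
    obtain ⟨r, hr⟩ := IntermediateField.mem_bot.1 this
    exact ⟨r, by simpa using hr⟩
  obtain ⟨θ, hθ⟩ : ∃ θ, σ θ ≠ θ := by
    by_contra! h
    exact hσ (AlgEquiv.ext h)
  obtain ⟨α, hα, hσα⟩ : ∃ α, α ≠ 0 ∧ σ α = -α :=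
    ⟨θ - σ θ, sub_ne_zero.2 hθ.symm, by simp [hσσ]⟩
  obtain ⟨r, hr⟩ := hfix (α ^ 2) (by simp [hσα])
  have hr0 : r < 0 := by
    by_contra! hr0
    obtain ⟨φ⟩ : Nonempty (F →+* ℂ) := inferInstance
    have him : (φ α).im = 0 := by
      have h : (φ α) ^ 2 = (r : ℂ) := by rw [← map_pow, ← hr, map_ratCast]
      have hre := congrArg Complex.re h
      have him := congrArg Complex.im h
      have hr' : (0 : ℝ) ≤ r := by exact_mod_cast hr0
      simp only [pow_two, Complex.mul_re, Complex.mul_im, Complex.ratCast_re,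
        Complex.ratCast_im] at hre him
      have h3 : (φ α).re * (φ α).im = 0 := by linarith
      rcases mul_eq_zero.1 h3 with h | h
      · rw [h] at hre
        nlinarith
      · exact h
    have hφ : ComplexEmbedding.IsReal φ := by
      refine RingHom.ext fun x => ?_
      rw [ComplexEmbedding.conjugate_coe_eq, Complex.conj_eq_iff_im]
      obtain ⟨u, hu⟩ := hfix (x + σ x) (by rw [map_add, hσσ, add_comm])
      obtain ⟨v, hv⟩ := hfix ((x - σ x) / α) (by
        rw [map_div₀, map_sub, hσσ, hσα, div_neg, ← neg_div, neg_sub])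
      have hx : 2 * x = u + v * α := by
        rw [hu, hv, div_mul_cancel₀ _ hα]
        ring
      have h := congrArg (fun y => (φ y).im) hx
      rw [two_mul] at h
      simp [him] at h
      linarith
    exact hreal.false (ComplexEmbedding.IsReal.embedding hφ)
  obtain ⟨d, s, hds, hd⟩ := Nat.sq_mul_squarefree (r.num.natAbs * r.den)
  have hnum : (r.num : ℚ) = -(r.num.natAbs : ℚ) := by
    have h : r.num = -(r.num.natAbs : ℤ) := by
      have := Rat.num_neg.2 hr0
      omega
    rw [← Int.cast_natCast, ← Int.cast_neg, ← h]
  have hs : s ≠ 0 := by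
    rintro rfl
    have h1 : r.num.natAbs ≠ 0 := Int.natAbs_ne_zero.2 (Rat.num_ne_zero.2 hr0.ne)
    exact mul_ne_zero h1 r.den_ne_zero (by rw [← hds]; simp)
  refine ⟨σ, r.den * α / s, d, hd, ?_, by simp [hσα, neg_div]⟩
  have hs' : (s : F) ≠ 0 := by exact_mod_cast hs
  have hq : (r.den : ℚ) ^ 2 * r = -((s : ℚ) ^ 2 * d) := by
    have h1 : (s : ℚ) ^ 2 * d = r.num.natAbs * r.den := by exact_mod_cast hds
    rw [h1, ← neg_mul, ← hnum]
    nth_rewrite 2 [← Rat.num_div_den r]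
    have := r.den_ne_zero
    field_simp
  have hF : (r.den : F) ^ 2 * r = -((s : F) ^ 2 * d) := by
    exact_mod_cast congrArg (Rat.cast : ℚ → F) hq
  rw [div_pow, mul_pow, ← hr, hF]
  field_simp

theorem absNorm_span_natCast_of_finrank_eq_two (h2 : Module.finrank ℚ F = 2) (n : ℕ) :
    Ideal.absNorm (Ideal.span {(n : 𝓞 F)}) = n ^ 2 := by
  rw [Ideal.absNorm_span_singleton, show (n : 𝓞 F) = algebraMap ℤ (𝓞 F) n by simp,
    Algebra.norm_algebraMap, RingOfIntegers.rank, h2]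
  simp [Int.natAbs_pow]

theorem one_notMem_span_prime (h2 : Module.finrank ℚ F = 2) {p : ℕ} (hp : p.Prime) :
    (1 : 𝓞 F) ∉ Ideal.span {(p : 𝓞 F)} := fun h => by
  have h1 := absNorm_span_natCast_of_finrank_eq_two h2 p
  rw [(Ideal.eq_top_iff_one _).2 h, Ideal.absNorm_top] at h1
  exact hp.one_lt.ne (Nat.pow_left_injective two_ne_zero (by simpa using h1))

/-- For squarefree `d`, a prime dividing `d` ramifies in a quadratic field containing `√-d`. -/
theorem ratPrimeRamifies_of_dvd (h2 : Module.finrank ℚ F = 2) {a : 𝓞 F} {d q : ℕ}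
    (hd : Squarefree d) (ha : a ^ 2 = -(d : 𝓞 F)) (hq : q.Prime) (hqd : q ∣ d) :
    RatPrimeRamifies F q := by
  obtain ⟨e, rfl⟩ := hqd
  have hcop : Nat.Coprime q e := Nat.coprime_of_squarefree_mul hd
  obtain ⟨u, v, huv⟩ : IsCoprime (q : ℤ) e := Nat.isCoprime_iff_coprime.2 hcop
  have huv' : (u : 𝓞 F) * q + v * e = 1 := by exact_mod_cast congrArg (Int.cast : ℤ → 𝓞 F) huv
  set P : Ideal (𝓞 F) := Ideal.span {(q : 𝓞 F), a} with hP
  push_cast at ha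
  have hsq : P ^ 2 = Ideal.span {(q : 𝓞 F)} := by
    rw [pow_two, hP, Ideal.span_pair_mul_span_pair]
    refine le_antisymm (Ideal.span_le.2 ?_) ((Ideal.span_singleton_le_iff_mem _).2 ?_)
    · rintro x (rfl | rfl | rfl | rfl) <;> rw [SetLike.mem_coe, Ideal.mem_span_singleton]
      · exact dvd_mul_right _ _
      · exact dvd_mul_right _ _
      · exact dvd_mul_left _ _
      · exact ⟨-e, by rw [← pow_two, ha]; ring⟩
    · have h : (q : 𝓞 F) = u * (q * q) + (-v) * (a * a) := by
        linear_combination (-q) * huv' + v * ha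
      have hqq : (q * q : 𝓞 F) ∈ Ideal.span {(q * q : 𝓞 F), q * a, a * q, a * a} :=
        Ideal.subset_span (by simp)
      have haa : a * a ∈ Ideal.span {(q * q : 𝓞 F), q * a, a * q, a * a} :=
        Ideal.subset_span (by simp)
      have := add_mem (Ideal.mul_mem_left _ (u : 𝓞 F) hqq) (Ideal.mul_mem_left _ (-v : 𝓞 F) haa)
      rwa [← h] at this
  refine ⟨P, Ideal.isPrime_of_irreducible_absNorm ?_, hsq.dvd⟩
  have hn := absNorm_span_natCast_of_finrank_eq_two h2 q
  rw [← hsq, map_pow] at hn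
  rwa [Nat.pow_left_injective two_ne_zero hn]

/-- An odd prime dividing `d + x²` but not `x` splits in the quadratic field generated by
`√-d`. -/
theorem ratPrimeSplits_of_dvd (h2 : Module.finrank ℚ F = 2) (σ : F ≃ₐ[ℚ] F) {a : 𝓞 F}
    {d p x : ℕ} (ha : a ^ 2 = -(d : 𝓞 F)) (hσ : σ a = -(a : F)) (hp : p.Prime)
    (hpd : p ∣ d + x ^ 2) (hcop : Nat.Coprime p (2 * x)) : RatPrimeSplits F p := by
  obtain ⟨e, he⟩ := hpd
  have he' : (d : 𝓞 F) + x ^ 2 = p * e := by exact_mod_cast congrArg (Nat.cast : ℕ → 𝓞 F) he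
  obtain ⟨u, v, huv⟩ : IsCoprime (p : ℤ) (2 * x : ℕ) := Nat.isCoprime_iff_coprime.2 hcop
  have huv' : (u : 𝓞 F) * p + v * (2 * x) = 1 := by
    exact_mod_cast congrArg (Int.cast : ℤ → 𝓞 F) huv
  have hunit : ∀ I : Ideal (𝓞 F), (p : 𝓞 F) ∈ I → (2 * x : 𝓞 F) ∈ I → (1 : 𝓞 F) ∈ I :=
    fun I h h' => huv' ▸ add_mem (I.mul_mem_left _ h) (I.mul_mem_left _ h')
  have hone := one_notMem_span_prime h2 hp
  set P : Ideal (𝓞 F) := Ideal.span {(p : 𝓞 F), a + x} with hP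
  set Q : Ideal (𝓞 F) := Ideal.span {(p : 𝓞 F), a - x} with hQ
  have hpP : (p : 𝓞 F) ∈ P := Ideal.subset_span (by simp)
  have hpQ : (p : 𝓞 F) ∈ Q := Ideal.subset_span (by simp)
  have haP : a + x ∈ P := Ideal.subset_span (by simp)
  have haQ : a - x ∈ Q := Ideal.subset_span (by simp)
  have hmul : P * Q = Ideal.span {(p : 𝓞 F)} := by
    refine le_antisymm ?_ ((Ideal.span_singleton_le_iff_mem _).2 ?_)
    · rw [hP, hQ, Ideal.span_pair_mul_span_pair]
      refine Ideal.span_le.2 ?_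
      rintro y (rfl | rfl | rfl | rfl) <;> rw [SetLike.mem_coe, Ideal.mem_span_singleton]
      · exact dvd_mul_right _ _
      · exact dvd_mul_right _ _
      · exact dvd_mul_left _ _
      · exact ⟨-e, by linear_combination ha - he'⟩
    · have h : (p : 𝓞 F) = u * (p * p) + (v * ((a + x) * p) + -v * (p * (a - x))) := by
        linear_combination (-p) * huv'
      rw [h]
      exact add_mem (Ideal.mul_mem_left _ _ (Ideal.mul_mem_mul hpP hpQ))
        (add_mem (Ideal.mul_mem_left _ _ (Ideal.mul_mem_mul haP hpQ))
          (Ideal.mul_mem_left _ _ (Ideal.mul_mem_mul hpP haQ)))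
  have hconj : ∀ b : 𝓞 F, b ∈ Ideal.span {(p : 𝓞 F)} →
      RingOfIntegers.mapRingHom (σ : F →+* F) b ∈ Ideal.span {(p : 𝓞 F)} := by
    intro b hb
    rw [Ideal.mem_span_singleton] at hb ⊢
    simpa using map_dvd (RingOfIntegers.mapRingHom (σ : F →+* F)) hb
  have hσa : RingOfIntegers.mapRingHom (σ : F →+* F) a = -a := RingOfIntegers.ext (by simpa using hσ)
  have hPtop : P ≠ ⊤ := fun h => hone <| hunit _ (Ideal.mem_span_singleton_self _) <| by
    rw [h, Ideal.top_mul] at hmul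
    rw [hmul] at haQ
    have := neg_mem (add_mem haQ (hconj _ haQ))
    rw [map_sub, hσa, map_natCast] at this
    convert this using 1
    ring
  have hQtop : Q ≠ ⊤ := fun h => hone <| hunit _ (Ideal.mem_span_singleton_self _) <| by
    rw [h, Ideal.mul_top] at hmul
    rw [hmul] at haP
    have := add_mem haP (hconj _ haP)
    rw [map_add, hσa, map_natCast] at this
    convert this using 1
    ring
  have hn := absNorm_span_natCast_of_finrank_eq_two h2 p
  rw [← hmul, map_mul] at hn
  obtain ⟨hNP, hNQ⟩ := (Nat.Prime.mul_eq_prime_sq_iff hp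
    (mt Ideal.absNorm_eq_one_iff.1 hPtop) (mt Ideal.absNorm_eq_one_iff.1 hQtop)).1 hn
  refine ⟨P, Q, Ideal.isPrime_of_irreducible_absNorm (by rwa [hNP]),
    Ideal.isPrime_of_irreducible_absNorm (by rwa [hNQ]), fun hPQ => ?_, hmul.symm⟩
  refine hPtop ((Ideal.eq_top_iff_one _).2 (hunit _ hpP ?_))
  rw [← hPQ] at haQ
  convert sub_mem haP haQ using 1
  ring

end QuadraticField

/-- For `d ≠ 0` there is an odd prime `p` coprime to `x` dividing `d + x²`, for some
`x ≤ 2`. -/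
theorem exists_prime_dvd_add_sq {d : ℕ} (hd : d ≠ 0) :
    ∃ p x : ℕ, p.Prime ∧ p ∣ d + x ^ 2 ∧ Nat.Coprime p (2 * x) ∧ p ≤ d + 4 := by
  have key : ∀ x : ℕ, Odd (d + x ^ 2) → x ∣ 2 → d + x ^ 2 ≤ d + 4 → 1 < d + x ^ 2 →
      ∃ p x : ℕ, p.Prime ∧ p ∣ d + x ^ 2 ∧ Nat.Coprime p (2 * x) ∧ p ≤ d + 4 := by
    intro x hodd hx hle h1
    have hp := Nat.minFac_prime h1.ne'
    have hdvd := Nat.minFac_dvd (d + x ^ 2)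
    have hp2 : Nat.Coprime (d + x ^ 2).minFac 2 :=
      Nat.coprime_two_right.2 (hodd.of_dvd_nat hdvd)
    exact ⟨_, x, hp, hdvd, hp2.mul_right (hp2.coprime_dvd_right hx),
      (Nat.minFac_le (by omega)).trans hle⟩
  rcases Nat.even_or_odd d with h | h
  · exact key 1 (h.add_odd (by decide)) (by decide) (by omega) (by omega)
  · exact key 2 (h.add_even (by decide)) (by decide) (by omega) (by omega)

/-- There is an effectively computable constant `c > 0` such that every imaginary quadratic
field `F`, with `S` the set of rational primes ramifying in `F`, admits a split rational
prime `p ≤ 2·(4·∏_{q∈S} q)^c`. -/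
theorem exists_small_split_prime_unconditional :
    ∃ c : ℝ, 0 < c ∧
      ∀ (F : Type) [Field F] [NumberField F],
        Module.finrank ℚ F = 2 →
        IsEmpty (F →+* ℝ) →
        ∀ S : Finset ℕ,
          (∀ q : ℕ, q ∈ S ↔ q.Prime ∧ RatPrimeRamifies F q) →
          ∃ p : ℕ, p.Prime ∧
            (p : ℝ) ≤ 2 * ((4 : ℝ) * ∏ q ∈ S, (q : ℝ)) ^ c ∧
            RatPrimeSplits F p := by
  refine ⟨1, one_pos, fun F _ _ h2 hreal S hS => ?_⟩
  obtain ⟨σ, α, d, hd, hα, hσα⟩ := exists_sq_eq_neg_squarefree h2 hreal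
  have hint : IsIntegral ℤ α :=
    IsIntegral.of_pow two_pos (hα ▸ (map_natCast (algebraMap ℤ F) d ▸ isIntegral_algebraMap).neg)
  obtain ⟨a, rfl⟩ : ∃ a : 𝓞 F, (a : F) = α := ⟨⟨α, hint⟩, rfl⟩
  have ha : a ^ 2 = -(d : 𝓞 F) := RingOfIntegers.ext (by simpa using hα)
  obtain ⟨p, x, hp, hpd, hcop, hle⟩ := exists_prime_dvd_add_sq hd.ne_zero
  refine ⟨p, hp, ?_, ratPrimeSplits_of_dvd h2 σ ha hσα hp hpd hcop⟩
  have hsub : d.primeFactors ⊆ S := fun q hq =>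
    (hS q).2 ⟨Nat.prime_of_mem_primeFactors hq, ratPrimeRamifies_of_dvd h2 hd ha
      (Nat.prime_of_mem_primeFactors hq) (Nat.dvd_of_mem_primeFactors hq)⟩
  have hdS : d ≤ ∏ q ∈ S, q := by
    rw [← Nat.prod_primeFactors_of_squarefree hd]
    exact Finset.prod_le_prod_of_subset_of_one_le' hsub fun q hq _ => ((hS q).1 hq).1.one_le
  have hbound : p ≤ 2 * (4 * ∏ q ∈ S, q) := by
    have := Nat.pos_of_ne_zero hd.ne_zero
    omega
  rw [Real.rpow_one]
  have : (p : ℝ) ≤ ((2 * (4 * ∏ q ∈ S, q) : ℕ) : ℝ) := Nat.cast_le.2 hbound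
  simpa using this
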